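/- Equality of optimal values for sandwiched index sets: Let I ⊆ Fin n, let α̂ be a maximizer of f over F(I), and let J be any index set with supp(α̂) ⊆ J ⊆ I. Then sSup (f '' F(J)) = sSup (f '' F(I)). -/

import Mathlib

open Finset

noncomputable def svmObj {n : ℕ} (y : Fin n → ℝ) (Q : Matrix (Fin n) (Fin n) ℝ)
    (α : Fin n → ℝ) : ℝ :=
  (∑ i, α i) - (1/2) * ∑ i, ∑ j, α i * α j * y i * y j * Q i j

def svmFeasible {n : ℕ} (y : Fin n → ℝ) (C : ℝ) (I : Set (Fin n)) : Set (Fin n → ℝ) :=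
  {α | (∀ i, 0 ≤ α i ∧ α i ≤ C) ∧ (∑ i, α i * y i = 0) ∧ ∀ i ∉ I, α i = 0}

def svmSupp {n : ℕ} (α : Fin n → ℝ) : Set (Fin n) := {i | α i ≠ 0}

theorem svmFeasible_mono {n : ℕ} (y : Fin n → ℝ) (C : ℝ) {I J : Set (Fin n)} (hJI : J ⊆ I) :
    svmFeasible y C J ⊆ svmFeasible y C I :=
  fun _ ⟨hbox, hbal, hzero⟩ => ⟨hbox, hbal, fun i hi => hzero i fun hiJ => hi (hJI hiJ)⟩

theorem mem_svmFeasible_of_svmSupp_subset {n : ℕ} {y : Fin n → ℝ} {C : ℝ} {I J : Set (Fin n)}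
    {α : Fin n → ℝ} (hα : α ∈ svmFeasible y C I) (hsupp : svmSupp α ⊆ J) :
    α ∈ svmFeasible y C J :=
  ⟨hα.1, hα.2.1, fun _ hi => by_contra fun hne => hi (hsupp hne)⟩

theorem svm_sandwich_optimal_values (n : ℕ) (y : Fin n → ℝ) (Q : Matrix (Fin n) (Fin n) ℝ)
    (C : ℝ) (hC : 0 < C) (I J : Set (Fin n)) (αhat : Fin n → ℝ)
    (hαI : αhat ∈ svmFeasible y C I)
    (hopt : ∀ β ∈ svmFeasible y C I, svmObj y Q β ≤ svmObj y Q αhat)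
    (hsupp : svmSupp αhat ⊆ J) (hJI : J ⊆ I) :
    sSup (svmObj y Q '' svmFeasible y C J) = sSup (svmObj y Q '' svmFeasible y C I) := by
  have hI : IsGreatest (svmObj y Q '' svmFeasible y C I) (svmObj y Q αhat) :=
    ⟨Set.mem_image_of_mem _ hαI, Set.forall_mem_image.2 hopt⟩
  have hJ : IsGreatest (svmObj y Q '' svmFeasible y C J) (svmObj y Q αhat) :=
    ⟨Set.mem_image_of_mem _ (mem_svmFeasible_of_svmSupp_subset hαI hsupp),
      upperBounds_mono_set (Set.image_mono (svmFeasible_mono y C hJI)) hI.2⟩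
  rw [hJ.csSup_eq, hI.csSup_eq]
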